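/- (Explicit Weil operators satisfy the Egorov identity) Define the following operators on ℂ(ZMod p): for a ∈ (ZMod p)ˣ, S_a[f](x) = σ(a)·f(a⁻¹·x); for b ∈ ZMod p, M_b[f](x) = ψ(−2⁻¹·b·x²)·f(x); and F[f](y) = p^(−1/2)·Σ_x ψ(y·x)·f(x). Then for all t, w', z ∈ ZMod p: (1) S_a ∘ π((t,w'),z) ∘ S_a⁻¹ = π((a·t, a⁻¹·w'), z); (2) M_b ∘ π((t,w'),z) ∘ M_b⁻¹ = π((t, b·t + w'), z); (3) F ∘ π((t,w'),z) ∘ F⁻¹ = π((w', −t), z). That is, S_a, M_b, F satisfy the Egorov identity for the elements [[a,0],[0,a⁻¹]], [[1,0],[b,1]], [[0,1],[−1,0]] of SL(2, ZMod p), respectively. -/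

import Mathlib

open scoped BigOperators

noncomputable section

namespace DFTWeil

open scoped Classical

/-- Multiplication of the Heisenberg group `H = (V × V) × Z`,
`(v,z)·(v',z') = (v+v', z+z'+2⁻¹ ω(v,v'))` with `ω((t,w),(t',w')) = t w' - w t'`. -/
def hMul {p : ℕ} (a b : (ZMod p × ZMod p) × ZMod p) : (ZMod p × ZMod p) × ZMod p :=
  (a.1 + b.1, a.2 + b.2 + (2 : ZMod p)⁻¹ * (a.1.1 * b.1.2 - a.1.2 * b.1.1))

/-- The additive character `ψ(z) = exp(2πi z/p)`. -/
def psi (p : ℕ) (z : ZMod p) : ℂ :=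
  Complex.exp (2 * Real.pi * Complex.I * (z.val : ℂ) / p)

/-- The standard realization of the Heisenberg representation:
`(π((t,w),z) f)(x) = ψ(z + 2⁻¹ t w + w x) f(x+t)`. -/
def heis (p : ℕ) (h : (ZMod p × ZMod p) × ZMod p) :
    (ZMod p → ℂ) →ₗ[ℂ] (ZMod p → ℂ) where
  toFun f x := psi p (h.2 + (2 : ZMod p)⁻¹ * h.1.1 * h.1.2 + h.1.2 * x) * f (x + h.1.1)
  map_add' f g := by funext x; simp [mul_add]
  map_smul' c f := by funext x; simp [Pi.smul_apply, smul_eq_mul]; ring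

/-- The Legendre character `σ` of `ZMod p` (extended by `0` at `0`). -/
def sgm (p : ℕ) (a : ZMod p) : ℂ := if a = 0 then 0 else if IsSquare a then 1 else -1

/-- Action of a `2 × 2` matrix on a column vector `v ∈ (ZMod p)²`. -/
def matVec {p : ℕ} (m : Matrix (Fin 2) (Fin 2) (ZMod p)) (v : ZMod p × ZMod p) :
    ZMod p × ZMod p :=
  (m 0 0 * v.1 + m 0 1 * v.2, m 1 0 * v.1 + m 1 1 * v.2)

/-- The symplectic form `ω((t,w),(t',w')) = t w' - w t'`. -/
def omg {p : ℕ} (v w : ZMod p × ZMod p) : ZMod p := v.1 * w.2 - v.2 * w.1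

/-- The Cayley transform `κ(g) = (g+I)(g-I)⁻¹`. -/
def cayley {p : ℕ} (g : Matrix (Fin 2) (Fin 2) (ZMod p)) : Matrix (Fin 2) (Fin 2) (ZMod p) :=
  (g + 1) * (g - 1)⁻¹

/-- The Weil operator given by the kernel formula
`ρ(g) = p⁻¹ σ(-det(κ(g)+I)) Σ_v ψ(4⁻¹ ω(κ(g)v,v)) π(v,0)`. -/
def weilOp (p : ℕ) [Fact p.Prime] (g : Matrix (Fin 2) (Fin 2) (ZMod p)) :
    (ZMod p → ℂ) →ₗ[ℂ] (ZMod p → ℂ) :=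
  (p : ℂ)⁻¹ • sgm p (-((cayley g + 1).det)) •
    ∑ v : ZMod p × ZMod p,
      psi p ((4 : ZMod p)⁻¹ * omg (matVec (cayley g) v) v) • heis p (v, 0)

/-- The discrete Fourier transform `F[f](y) = p^(-1/2) Σ_x ψ(yx) f(x)`. -/
def dft (p : ℕ) [Fact p.Prime] : Module.End ℂ (ZMod p → ℂ) where
  toFun f y := ((Real.sqrt p : ℂ))⁻¹ * ∑ x : ZMod p, psi p (y * x) * f x
  map_add' f g := by funext y; simp [mul_add, Finset.sum_add_distrib]
  map_smul' c f := by
    funext y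
    simp [Pi.smul_apply, smul_eq_mul, Finset.mul_sum]
    ring_nf
    congr 1
    ext x
    ring

/-- The scaling operator `S_a[f](x) = σ(a) f(a⁻¹ x)`. -/
def scaleOp (p : ℕ) [Fact p.Prime] (a : ZMod p) : (ZMod p → ℂ) →ₗ[ℂ] (ZMod p → ℂ) where
  toFun f x := sgm p a * f (a⁻¹ * x)
  map_add' f g := by funext x; simp [mul_add]
  map_smul' c f := by funext x; simp [Pi.smul_apply, smul_eq_mul]; ring

/-- The chirp operator `M_b[f](x) = ψ(-2⁻¹ b x²) f(x)`. -/
def chirpOp (p : ℕ) [Fact p.Prime] (b : ZMod p) : (ZMod p → ℂ) →ₗ[ℂ] (ZMod p → ℂ) where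
  toFun f x := psi p (-((2 : ZMod p)⁻¹ * b * x ^ 2)) * f x
  map_add' f g := by funext x; simp [mul_add]
  map_smul' c f := by funext x; simp [Pi.smul_apply, smul_eq_mul]; ring

lemma psi_eq_stdAddChar (p : ℕ) [Fact p.Prime] (z : ZMod p) :
    psi p z = ZMod.stdAddChar z := by
  rw [ZMod.stdAddChar_apply, ZMod.toCircle_apply, psi]

lemma psi_add (p : ℕ) [Fact p.Prime] (x y : ZMod p) : psi p (x + y) = psi p x * psi p y := by
  simp only [psi_eq_stdAddChar, AddChar.map_add_eq_mul]

lemma psi_ne_zero (p : ℕ) (x : ZMod p) : psi p x ≠ 0 := Complex.exp_ne_zero _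

lemma sgm_ne_zero {p : ℕ} {a : ZMod p} (ha : a ≠ 0) : sgm p a ≠ 0 := by
  rw [sgm, if_neg ha]
  split_ifs <;> simp

lemma bijective_of_injective {p : ℕ} [Fact p.Prime] {L : (ZMod p → ℂ) →ₗ[ℂ] (ZMod p → ℂ)}
    (h : Function.Injective L) : Function.Bijective L :=
  ⟨h, LinearMap.injective_iff_surjective.mp h⟩

lemma dft_apply_eq_zmod_dft (p : ℕ) [Fact p.Prime] (f : ZMod p → ℂ) (y : ZMod p) :
    dft p f y = ((Real.sqrt p : ℂ))⁻¹ * ZMod.dft f (-y) := by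
  simp only [dft, LinearMap.coe_mk, AddHom.coe_mk, ZMod.dft_apply, smul_eq_mul,
    psi_eq_stdAddChar, mul_neg, neg_neg, mul_comm y]

lemma scaleOp_injective (p : ℕ) [Fact p.Prime] {a : ZMod p} (ha : a ≠ 0) :
    Function.Injective (scaleOp p a) := by
  intro f g h
  funext x
  have h' := congrFun h (a * x)
  simp only [scaleOp, LinearMap.coe_mk, AddHom.coe_mk, inv_mul_cancel_left₀ ha] at h'
  exact mul_left_cancel₀ (sgm_ne_zero ha) h'

lemma chirpOp_injective (p : ℕ) [Fact p.Prime] (b : ZMod p) :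
    Function.Injective (chirpOp p b) := by
  intro f g h
  funext x
  exact mul_left_cancel₀ (psi_ne_zero p _) (congrFun h x)

lemma dft_injective (p : ℕ) [Fact p.Prime] : Function.Injective (dft p) := by
  intro f g h
  apply ZMod.dft.injective
  funext y
  have h' := congrFun h (-y)
  simp only [dft_apply_eq_zmod_dft, neg_neg] at h'
  refine mul_left_cancel₀ (inv_ne_zero ?_) h'
  have hp : (0 : ℝ) < p := Nat.cast_pos.mpr (Fact.out : p.Prime).pos
  exact_mod_cast (Real.sqrt_pos.mpr hp).ne'

lemma scaleOp_comp_heis (p : ℕ) [Fact p.Prime] {a : ZMod p} (ha : a ≠ 0) (t w z : ZMod p) :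
    scaleOp p a ∘ₗ heis p ((t, w), z) = heis p ((a * t, a⁻¹ * w), z) ∘ₗ scaleOp p a := by
  refine LinearMap.ext fun f => funext fun x => ?_
  simp only [scaleOp, heis, LinearMap.comp_apply, LinearMap.coe_mk, AddHom.coe_mk]
  have hx : a⁻¹ * (x + a * t) = a⁻¹ * x + t := by field_simp
  have hz : z + 2⁻¹ * (a * t) * (a⁻¹ * w) + a⁻¹ * w * x = z + 2⁻¹ * t * w + w * (a⁻¹ * x) := by
    linear_combination 2⁻¹ * t * w * mul_inv_cancel₀ ha
  rw [hx, hz]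
  ring

lemma chirpOp_comp_heis (p : ℕ) [Fact p.Prime] (hp : p ≠ 2) (b t w z : ZMod p) :
    chirpOp p b ∘ₗ heis p ((t, w), z) = heis p ((t, b * t + w), z) ∘ₗ chirpOp p b := by
  have h2 : (2 : ZMod p) ≠ 0 := Ring.two_ne_zero (by rwa [ZMod.ringChar_zmod_n])
  refine LinearMap.ext fun f => funext fun x => ?_
  simp only [chirpOp, heis, LinearMap.comp_apply, LinearMap.coe_mk, AddHom.coe_mk]
  rw [← mul_assoc, ← mul_assoc, ← psi_add, ← psi_add]
  congr 2
  linear_combination b * t * x * mul_inv_cancel₀ h2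

lemma dft_comp_heis (p : ℕ) [Fact p.Prime] (hp : p ≠ 2) (t w z : ZMod p) :
    (dft p : (ZMod p → ℂ) →ₗ[ℂ] (ZMod p → ℂ)) ∘ₗ heis p ((t, w), z) =
      heis p ((w, -t), z) ∘ₗ (dft p : (ZMod p → ℂ) →ₗ[ℂ] (ZMod p → ℂ)) := by
  have h2 : (2 : ZMod p) ≠ 0 := Ring.two_ne_zero (by rwa [ZMod.ringChar_zmod_n])
  refine LinearMap.ext fun f => funext fun y => ?_
  simp only [dft, heis, LinearMap.comp_apply, LinearMap.coe_mk, AddHom.coe_mk]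
  rw [mul_left_comm (psi p _), Finset.mul_sum _ _ (psi p _)]
  congr 1
  refine Fintype.sum_equiv (Equiv.addRight t) _ _ fun x => ?_
  rw [Equiv.coe_addRight, ← mul_assoc, ← mul_assoc, ← psi_add, ← psi_add]
  congr 2
  linear_combination t * w * mul_inv_cancel₀ h2

/-- The explicit Weil operators `S_a`, `M_b`, `F` are invertible and satisfy the Egorov
identity for `[[a,0],[0,a⁻¹]]`, `[[1,0],[b,1]]` and `[[0,1],[-1,0]]` respectively. -/
theorem stmt18 (p : ℕ) [Fact p.Prime] (hp : p ≠ 2) (a b : ZMod p) (ha : a ≠ 0) :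
    Function.Bijective (scaleOp p a) ∧ Function.Bijective (chirpOp p b) ∧
    Function.Bijective (dft p) ∧
    (∀ t w z : ZMod p,
      scaleOp p a ∘ₗ heis p ((t, w), z) = heis p ((a * t, a⁻¹ * w), z) ∘ₗ scaleOp p a) ∧
    (∀ t w z : ZMod p,
      chirpOp p b ∘ₗ heis p ((t, w), z) = heis p ((t, b * t + w), z) ∘ₗ chirpOp p b) ∧
    (∀ t w z : ZMod p,
      (dft p : (ZMod p → ℂ) →ₗ[ℂ] (ZMod p → ℂ)) ∘ₗ heis p ((t, w), z) =
        heis p ((w, -t), z) ∘ₗ (dft p : (ZMod p → ℂ) →ₗ[ℂ] (ZMod p → ℂ))) :=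
  ⟨bijective_of_injective (scaleOp_injective p ha),
    bijective_of_injective (chirpOp_injective p b),
    bijective_of_injective (dft_injective p),
    scaleOp_comp_heis p ha, chirpOp_comp_heis p hp b, dft_comp_heis p hp⟩

end DFTWeil
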